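/- A state ω on M_k(ℂ) ⊗ M_l(ℂ) with k = l = 2 (or k=2, l=3) is separable if and only if (id ⊗ t)ω ≥ 0, i.e., the partial transpose of its density matrix is positive semidefinite. -/

import Mathlib

open Matrix ComplexOrder
open scoped Kronecker

variable {l : ℕ}

/-- A density matrix is separable if it is a convex combination of tensor products of
density matrices. -/
def Separable (ρ : Matrix (Fin 2 × Fin l) (Fin 2 × Fin l) ℂ) : Prop :=
  ∃ (n : ℕ) (p : Fin n → ℝ) (σ₁ : Fin n → Matrix (Fin 2) (Fin 2) ℂ)
    (σ₂ : Fin n → Matrix (Fin l) (Fin l) ℂ),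
    (∀ i, 0 ≤ p i) ∧ (∑ i, p i = 1) ∧
    (∀ i, (σ₁ i).PosSemidef ∧ (σ₁ i).trace = 1) ∧
    (∀ i, (σ₂ i).PosSemidef ∧ (σ₂ i).trace = 1) ∧
    ρ = ∑ i, (p i : ℂ) • (σ₁ i ⊗ₖ σ₂ i)

/-- The partial transpose `id ⊗ t`: transposition on the second tensor factor. -/
def partialTransposeSnd (ρ : Matrix (Fin 2 × Fin l) (Fin 2 × Fin l) ℂ) :
    Matrix (Fin 2 × Fin l) (Fin 2 × Fin l) ℂ :=
  Matrix.of fun p q => ρ (p.1, q.2) (q.1, p.2)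

/-- In finite dimension, the convex hull of a compact set is compact. -/
theorem isCompact_convexHull_fd {E : Type*} [NormedAddCommGroup E] [NormedSpace ℝ E]
    [FiniteDimensional ℝ E] {s : Set E} (hs : IsCompact s) : IsCompact (convexHull ℝ s) := by
  classical
  rcases s.eq_empty_or_nonempty with rfl | ⟨z0, hz0⟩
  · simp
  let d := Module.finrank ℝ E + 1
  let f : (Fin d → ℝ) × (Fin d → E) → E := fun p => ∑ i, p.1 i • p.2 i
  have hf : Continuous f := by
    dsimp only [f]; fun_prop
  have hK : IsCompact ((stdSimplex ℝ (Fin d)) ×ˢ (Set.pi Set.univ (fun _ : Fin d => s))) :=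
    (isCompact_stdSimplex ℝ (Fin d)).prod (isCompact_univ_pi fun _ => hs)
  have : convexHull ℝ s =
      f '' ((stdSimplex ℝ (Fin d)) ×ˢ (Set.pi Set.univ (fun _ : Fin d => s))) := by
    apply Set.Subset.antisymm
    · intro x hx
      obtain ⟨ι, _, z, w, hz, hai, hw, hw1, hx⟩ := eq_pos_convex_span_of_mem_convexHull hx
      have hcard : Fintype.card ι ≤ d := hai.card_le_finrank_succ.trans
        (Nat.succ_le_succ (Submodule.finrank_le _))
      let e : ι ↪ Fin d := (Fintype.equivFin ι).toEmbedding.trans (Fin.castLEEmb hcard)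
      have hext : ∀ g : ι → ℝ, ∀ i, Function.extend e g 0 (e i) = g i := fun g i =>
        e.injective.extend_apply _ _ _
      refine ⟨(Function.extend e w 0, Function.extend e z (fun _ => z0)), ⟨⟨?_, ?_⟩, ?_⟩, ?_⟩
      · intro i
        by_cases h : ∃ a, e a = i
        · obtain ⟨a, rfl⟩ := h
          simpa [hext] using (hw a).le
        · simp only; rw [Function.extend_apply' _ _ _ h]; simp
      · rw [← hw1]
        symm
        apply Fintype.sum_of_injective e e.injective
        · intro i hi
          exact Function.extend_apply' _ _ _ (by simpa using hi)
        · intro i; simp [hext]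
      · intro i _
        by_cases h : ∃ a, e a = i
        · obtain ⟨a, rfl⟩ := h
          simp only [e.injective.extend_apply]
          exact hz ⟨a, rfl⟩
        · simp only; rw [Function.extend_apply' _ _ _ h]; exact hz0
      · rw [← hx]
        symm
        apply Fintype.sum_of_injective e e.injective
        · intro i hi
          simp only
          rw [Function.extend_apply' _ _ _ (by simpa using hi)]; simp
        · intro i; simp [e.injective.extend_apply]
    · rintro _ ⟨⟨w, z⟩, ⟨⟨hw, hw1⟩, hz⟩, rfl⟩
      exact mem_convexHull_of_exists_fintype w z hw hw1 (fun i => hz i trivial) rfl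
  rw [this]
  exact hK.image hf

section normal
open scoped Matrix.Norms.L2Operator

/-- Spectral decomposition of a normal matrix. -/
theorem normal_decomp {m : Type*} [Fintype m] [DecidableEq m] (N : Matrix m m ℂ)
    (hN : N * Nᴴ = Nᴴ * N) :
    ∃ (s : Finset ℂ) (P : ℂ → Matrix m m ℂ), (∀ z ∈ s, (P z).PosSemidef) ∧
      ∑ z ∈ s, P z = 1 ∧ ∑ z ∈ s, z • P z = N ∧ ∑ z ∈ s, (z * star z) • P z = N * Nᴴ := by
  classical
  have hn : IsStarNormal N := ⟨by rw [star_eq_conjTranspose]; exact hN.symm⟩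
  have hfin : (spectrum ℂ N).Finite := Matrix.finite_spectrum N
  have hc : ∀ f : ℂ → ℂ, ContinuousOn f (spectrum ℂ N) := fun f => hfin.continuousOn f
  have key : ∀ f : ℂ → ℂ, ∑ z ∈ hfin.toFinset, f z • cfc (fun x => if x = z then (1:ℂ) else 0) N
      = cfc f N := by
    intro f
    have : ∀ z, f z • cfc (fun x => if x = z then (1:ℂ) else 0) N
        = cfc (fun x => f z • if x = z then (1:ℂ) else 0) N := fun z =>
      (cfc_smul _ _ _ (hc _)).symm
    simp_rw [this]
    rw [← cfc_sum _ _ _ (fun i _ => hc _)]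
    apply cfc_congr
    intro x hx
    simp only [Finset.sum_apply, smul_eq_mul, mul_ite, mul_one, mul_zero]
    rw [Finset.sum_ite_eq]
    simp [hx]
  refine ⟨hfin.toFinset, fun z => cfc (fun x => if x = z then (1:ℂ) else 0) N, ?_, ?_, ?_, ?_⟩
  · intro z _
    have : cfc (fun x => if x = z then (1:ℂ) else 0) N =
        (cfc (fun x => if x = z then (1:ℂ) else 0) N)ᴴ
          * cfc (fun x => if x = z then (1:ℂ) else 0) N := by
      rw [← star_eq_conjTranspose, ← cfc_star, ← cfc_mul _ _ _ (hc _) (hc _)]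
      congr 1
      ext x
      split_ifs <;> simp
    simp only
    rw [this]
    exact posSemidef_conjTranspose_mul_self _
  · have := key (fun _ => 1)
    simpa [cfc_const_one ℂ N] using this
  · have := key (fun x => x)
    rw [cfc_id' ℂ N] at this
    exact this
  · have := key (fun x => x * star x)
    rw [cfc_mul _ _ _ (hc _) (hc _), cfc_star, cfc_id' ℂ N] at this
    exact this
end normal

section basics

/-- Partial transposition on the first (qubit) factor, in block form. -/
def Gam {n : Type*} (M : Matrix (n ⊕ n) (n ⊕ n) ℂ) : Matrix (n ⊕ n) (n ⊕ n) ℂ :=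
  fromBlocks M.toBlocks₁₁ M.toBlocks₂₁ M.toBlocks₁₂ M.toBlocks₂₂

/-- Positive with positive partial transpose. -/
def PPT {n : Type*} (M : Matrix (n ⊕ n) (n ⊕ n) ℂ) : Prop := M.PosSemidef ∧ (Gam M).PosSemidef

/-- Kronecker product in block form. -/
def tens {n : Type*} (P : Matrix (Fin 2) (Fin 2) ℂ) (Q : Matrix n n ℂ) :
    Matrix (n ⊕ n) (n ⊕ n) ℂ :=
  fromBlocks (P 0 0 • Q) (P 0 1 • Q) (P 1 0 • Q) (P 1 1 • Q)

/-- The set of products of positive matrices. -/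
def prodSet (n : Type*) : Set (Matrix (n ⊕ n) (n ⊕ n) ℂ) :=
  {M | ∃ P Q, P.PosSemidef ∧ Q.PosSemidef ∧ M = tens P Q}

/-- The separable cone. -/
def SepC (n : Type*) : AddSubmonoid (Matrix (n ⊕ n) (n ⊕ n) ℂ) :=
  AddSubmonoid.closure (prodSet n)

/-- Local congruence. -/
def cg {n m : Type*} [Fintype n] (S : Matrix n m ℂ) (M : Matrix (n ⊕ n) (n ⊕ n) ℂ) :
    Matrix (m ⊕ m) (m ⊕ m) ℂ :=
  (fromBlocks S 0 0 S)ᴴ * M * fromBlocks S 0 0 S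

theorem cg_fromBlocks {n m : Type*} [Fintype n] (S : Matrix n m ℂ) (A B C D : Matrix n n ℂ) :
    cg S (fromBlocks A B C D) =
      fromBlocks (Sᴴ * A * S) (Sᴴ * B * S) (Sᴴ * C * S) (Sᴴ * D * S) := by
  simp [cg, fromBlocks_conjTranspose, fromBlocks_multiply]

theorem Gam_fromBlocks {n : Type*} (A B C D : Matrix n n ℂ) :
    Gam (fromBlocks A B C D) = fromBlocks A C B D := by
  simp [Gam]

theorem Gam_Gam {n : Type*} (M : Matrix (n ⊕ n) (n ⊕ n) ℂ) : Gam (Gam M) = M := by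
  simp [Gam, fromBlocks_toBlocks]

theorem Gam_add {n : Type*} (M N : Matrix (n ⊕ n) (n ⊕ n) ℂ) :
    Gam (M + N) = Gam M + Gam N := by
  ext (i | i) (j | j) <;> rfl

theorem Gam_smul {n : Type*} (c : ℂ) (M : Matrix (n ⊕ n) (n ⊕ n) ℂ) :
    Gam (c • M) = c • Gam M := by
  ext (i | i) (j | j) <;> rfl

theorem Gam_cg {n m : Type*} [Fintype n] (S : Matrix n m ℂ) (M : Matrix (n ⊕ n) (n ⊕ n) ℂ) :
    Gam (cg S M) = cg S (Gam M) := by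
  rw [← fromBlocks_toBlocks M, cg_fromBlocks, Gam_fromBlocks, Gam_fromBlocks, cg_fromBlocks]

theorem PPT.cg {n m : Type*} [Fintype n] [Fintype m] {M : Matrix (n ⊕ n) (n ⊕ n) ℂ} (h : PPT M)
    (S : Matrix n m ℂ) : PPT (cg S M) := by
  refine ⟨h.1.conjTranspose_mul_mul_same _, ?_⟩
  rw [Gam_cg]
  exact h.2.conjTranspose_mul_mul_same _

theorem PPT.add {n : Type*} {M N : Matrix (n ⊕ n) (n ⊕ n) ℂ} (h : PPT M)
    (h' : PPT N) : PPT (M + N) := ⟨h.1.add h'.1, by rw [Gam_add]; exact h.2.add h'.2⟩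

theorem PPT.smul {n : Type*} {M : Matrix (n ⊕ n) (n ⊕ n) ℂ} (h : PPT M)
    {c : ℂ} (hc : 0 ≤ c) : PPT (c • M) := ⟨h.1.smul hc, by rw [Gam_smul]; exact h.2.smul hc⟩

theorem tens_mem_SepC {n : Type*} {P : Matrix (Fin 2) (Fin 2) ℂ} {Q : Matrix n n ℂ}
    (hP : P.PosSemidef) (hQ : Q.PosSemidef) : tens P Q ∈ SepC n :=
  AddSubmonoid.subset_closure ⟨P, Q, hP, hQ, rfl⟩

theorem SepC_cg {n m : Type*} [Fintype n] [Fintype m] {M : Matrix (n ⊕ n) (n ⊕ n) ℂ}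
    (h : M ∈ SepC n) (S : Matrix n m ℂ) : cg S M ∈ SepC m := by
  induction h using AddSubmonoid.closure_induction with
  | mem x hx =>
    obtain ⟨P, Q, hP, hQ, rfl⟩ := hx
    refine AddSubmonoid.subset_closure ⟨P, Sᴴ * Q * S, hP, hQ.conjTranspose_mul_mul_same _, ?_⟩
    simp [tens, cg_fromBlocks]
  | zero => simp [cg]
  | add x y _ _ hx hy =>
    have : cg S (x + y) = cg S x + cg S y := by simp [cg, Matrix.mul_add, Matrix.add_mul]
    rw [this]; exact add_mem hx hy

theorem SepC_smul {n : Type*} {M : Matrix (n ⊕ n) (n ⊕ n) ℂ}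
    (h : M ∈ SepC n) {c : ℂ} (hc : 0 ≤ c) : c • M ∈ SepC n := by
  induction h using AddSubmonoid.closure_induction with
  | mem x hx =>
    obtain ⟨P, Q, hP, hQ, rfl⟩ := hx
    refine AddSubmonoid.subset_closure ⟨P, c • Q, hP, hQ.smul hc, ?_⟩
    simp [tens, fromBlocks_smul, smul_comm c]
  | zero => simp
  | add x y _ _ hx hy =>
    rw [smul_add]; exact add_mem hx hy

/-- Top-left corner blocks are separable. -/
theorem corner_mem_SepC {n : Type*} {Q : Matrix n n ℂ} (hQ : Q.PosSemidef) :
    fromBlocks Q 0 0 0 ∈ SepC n := by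
  have : fromBlocks Q 0 0 0 = tens (vecMulVec ![1, 0] (star ![1, 0])) Q := by
    simp [tens, vecMulVec_apply]
  rw [this]
  exact tens_mem_SepC (posSemidef_vecMulVec_self_star _) hQ

/-- Normal matrices give separable block matrices. -/
theorem normal_mem_SepC {m : Type*} [Fintype m] [DecidableEq m] (N : Matrix m m ℂ)
    (hN : N * Nᴴ = Nᴴ * N) : fromBlocks (N * Nᴴ) N Nᴴ 1 ∈ SepC m := by
  obtain ⟨s, P, hP, h1, h2, h3⟩ := normal_decomp N hN
  have h4 : ∑ z ∈ s, star z • P z = Nᴴ := by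
    rw [← h2, conjTranspose_sum]
    refine Finset.sum_congr rfl fun z hz => ?_
    rw [conjTranspose_smul, (hP z hz).1.eq]
  have : fromBlocks (N * Nᴴ) N Nᴴ 1 =
      ∑ z ∈ s, tens (vecMulVec ![z, 1] (star ![z, 1])) (P z) := by
    rw [← h3, ← h1, ← h4]
    conv_lhs => rw [← h2]
    ext (i | i) (j | j) <;> simp [tens, vecMulVec_apply, Matrix.sum_apply]
  rw [this]
  exact sum_mem fun z hz => tens_mem_SepC (posSemidef_vecMulVec_self_star _) (hP z hz)

end basics

section core

theorem scalar_aux (p q p' q' t : ℂ) (s : ℝ) (hts : ‖t‖ < s) (h1 : p * p' = q * q')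
    (h2 : (s : ℂ) * (star p * p + star q * q) - t * (star p * q) - star t * (star q * p)
      = (s : ℂ) * (star p' * p' + star q' * q') - t * (p' * star q') - star t * (q' * star p')) :
    ‖p‖ = ‖q'‖ := by
  set F : ℂ → ℂ → ℂ := fun a b =>
    (s : ℂ) * (star a * a + star b * b) - t * (star a * b) - star t * (star b * a) with hF
  have e1 : F p q = F q' p' := by
    simp only [hF]; rw [h2]; ring
  have e2 : star p * p * F q' p' = star q' * q' * F p q := by
    have h1' : star p * star p' = star q * star q' := by
      rw [← star_mul', h1, star_mul']
    have a1 : star p * p * F q' p' = (s : ℂ) * (star p * p * star q' * q' + (star p * star p') * (p * p'))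
      - t * (star p * star q' * (p * p')) - star t * ((star p * star p') * p * q') := by
      simp only [hF]; ring
    rw [a1, h1, h1']
    simp only [hF]; ring
  have e3 : (star p * p - star q' * q') * F p q = 0 := by
    rw [sub_mul, ← e2, e1]; ring
  have hlow : ∀ a b : ℂ, (s - ‖t‖) * (‖a‖ ^ 2 + ‖b‖ ^ 2) ≤ (F a b).re := by
    intro a b
    have hr : (F a b).re = s * (‖a‖ ^ 2 + ‖b‖ ^ 2) - 2 * (t * (star a * b)).re := by
      have hc : star t * (star b * a) = star (t * (star a * b)) := by
        simp only [star_mul', star_star]; ring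
      have ha : ∀ z : ℂ, star z * z = ((‖z‖ ^ 2 : ℝ) : ℂ) := by
        intro z; simp [Complex.conj_mul']
      simp only [hF]
      rw [hc, ha, ha, ← Complex.ofReal_add, ← Complex.ofReal_mul]
      simp only [Complex.sub_re, Complex.ofReal_re, Complex.star_def, Complex.conj_re]
      ring
    have hb : (t * (star a * b)).re ≤ ‖t‖ * (‖a‖ * ‖b‖) := by
      refine (Complex.re_le_norm _).trans ?_
      simp
    rw [hr]
    nlinarith [mul_nonneg (norm_nonneg t) (sq_nonneg (‖a‖ - ‖b‖))]
  rcases mul_eq_zero.1 e3 with h | h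
  · have : ((‖p‖ ^ 2 : ℝ) : ℂ) = ((‖q'‖ ^ 2 : ℝ) : ℂ) := by
      have ha : ∀ z : ℂ, star z * z = ((‖z‖ ^ 2 : ℝ) : ℂ) := by
        intro z; simp [Complex.conj_mul']
      rw [← ha, ← ha]; exact sub_eq_zero.1 h
    have := Complex.ofReal_injective this
    exact (sq_eq_sq₀ (norm_nonneg _) (norm_nonneg _)).1 this
  · have z : ∀ a b : ℂ, F a b = 0 → ‖a‖ = 0 := by
      intro a b hab
      have := hlow a b
      rw [hab, Complex.zero_re] at this
      have h3 : ‖a‖ ^ 2 + ‖b‖ ^ 2 ≤ 0 := by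
        by_contra hcon
        push Not at hcon
        have := mul_pos (sub_pos.2 hts) hcon
        linarith
      nlinarith [sq_nonneg ‖a‖, sq_nonneg ‖b‖]
    rw [z _ _ h, z _ _ (e1 ▸ h)]

theorem resolution (u v : Fin 3 → ℂ) (x y : Fin 3 → ℂ) :
    ((u ⨯₃ v) ⬝ᵥ star (u ⨯₃ v)) * (x ⬝ᵥ y) =
      (star v ⬝ᵥ v) * ((x ⬝ᵥ u) * (star u ⬝ᵥ y)) + (star u ⬝ᵥ u) * ((x ⬝ᵥ v) * (star v ⬝ᵥ y))
      - (star u ⬝ᵥ v) * ((x ⬝ᵥ u) * (star v ⬝ᵥ y)) - (star v ⬝ᵥ u) * ((x ⬝ᵥ v) * (star u ⬝ᵥ y))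
      + (x ⬝ᵥ star (u ⨯₃ v)) * ((u ⨯₃ v) ⬝ᵥ y) := by
  simp only [dotProduct, Fin.sum_univ_three, cross_apply, Pi.star_apply]
  simp
  ring

theorem core_trace (B : Matrix (Fin 3) (Fin 3) ℂ) (u v : Fin 3 → ℂ)
    (h : B * Bᴴ + vecMulVec u (star u) = Bᴴ * B + vecMulVec v (star v))
    (X : Matrix (Fin 3) (Fin 3) ℂ) (hX : B * X = X * B) :
    star u ⬝ᵥ X *ᵥ u = star v ⬝ᵥ X *ᵥ v := by
  have tr : ∀ w : Fin 3 → ℂ, trace (X * vecMulVec w (star w)) = star w ⬝ᵥ X *ᵥ w := by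
    intro w
    rw [mul_vecMulVec, trace_vecMulVec, dotProduct_comm]
  rw [← tr, ← tr]
  have h' : X * (B * Bᴴ) + X * vecMulVec u (star u) = X * (Bᴴ * B) + X * vecMulVec v (star v) := by
    rw [← Matrix.mul_add, h, Matrix.mul_add]
  have h2 := congrArg trace h'
  rw [trace_add, trace_add] at h2
  have h3 : trace (X * (B * Bᴴ)) = trace (X * (Bᴴ * B)) := by
    rw [← Matrix.mul_assoc, ← Matrix.mul_assoc, ← hX, Matrix.mul_assoc, trace_mul_comm]
  rw [h3] at h2
  exact add_left_cancel h2

/-- The `4 × 4` normal dilation. -/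
theorem dilation_mem_SepC (B : Matrix (Fin 3) (Fin 3) ℂ) (u v : Fin 3 → ℂ) (c : ℂ)
    (h : B * Bᴴ + vecMulVec u (star u) = Bᴴ * B + vecMulVec v (star v))
    (hs : star u ⬝ᵥ u = star v ⬝ᵥ v)
    (hc : B *ᵥ v + star c • u = Bᴴ *ᵥ u + c • v) :
    fromBlocks (B * Bᴴ + vecMulVec u (star u)) B Bᴴ 1 ∈ SepC (Fin 3) := by
  let U : Matrix (Fin 3) Unit ℂ := replicateCol Unit u
  let V : Matrix (Fin 3) Unit ℂ := replicateCol Unit v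
  let N : Matrix (Fin 3 ⊕ Unit) (Fin 3 ⊕ Unit) ℂ := fromBlocks B U Vᴴ (c • 1)
  have hUU : U * Uᴴ = vecMulVec u (star u) := by
    ext i j; simp [U, Matrix.mul_apply, vecMulVec_apply]
  have hVV : V * Vᴴ = vecMulVec v (star v) := by
    ext i j; simp [V, Matrix.mul_apply, vecMulVec_apply]
  have hsU : Uᴴ * U = Vᴴ * V := by
    ext i j
    have := hs
    simpa [U, V, Matrix.mul_apply, dotProduct] using this
  have hBV : B * V + star c • U = Bᴴ * U + c • V := by
    ext i j
    have := congrFun hc i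
    simpa [U, V, Matrix.mul_apply, mulVec, dotProduct] using this
  have hBV' : Vᴴ * Bᴴ + c • Uᴴ = Uᴴ * B + star c • Vᴴ := by
    have := congrArg conjTranspose hBV
    simpa [conjTranspose_add, conjTranspose_mul, conjTranspose_smul] using this
  have hN : N * Nᴴ = Nᴴ * N := by
    simp only [N, fromBlocks_conjTranspose, fromBlocks_multiply, conjTranspose_conjTranspose,
      conjTranspose_smul, conjTranspose_one, Matrix.mul_smul, Matrix.smul_mul, Matrix.mul_one,
      Matrix.one_mul]
    rw [hUU, hVV, h, hBV, hBV', hsU, smul_comm]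
  have h1 := SepC_cg (normal_mem_SepC N hN) (fromRows (1 : Matrix (Fin 3) (Fin 3) ℂ)
    (0 : Matrix Unit (Fin 3) ℂ))
  rw [cg_fromBlocks] at h1
  have hfr : ∀ X : Matrix (Fin 3 ⊕ Unit) (Fin 3 ⊕ Unit) ℂ,
      (fromRows (1 : Matrix (Fin 3) (Fin 3) ℂ) (0 : Matrix Unit (Fin 3) ℂ))ᴴ * X *
        fromRows (1 : Matrix (Fin 3) (Fin 3) ℂ) (0 : Matrix Unit (Fin 3) ℂ) = X.toBlocks₁₁ := by
    intro X
    rw [conjTranspose_fromRows_eq_fromCols_conjTranspose]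
    conv_lhs => rw [← fromBlocks_toBlocks X]
    simp [fromCols_mul_fromBlocks, fromCols_mul_fromRows]
  simp only [hfr] at h1
  convert h1 using 2
  · simp [N, fromBlocks_conjTranspose, fromBlocks_multiply, hUU]
  · simp [N]
  · simp [N, fromBlocks_conjTranspose]
  · ext i j; simp [toBlocks₁₁, Matrix.one_apply]

theorem star_dot {n : Type*} [Fintype n] (x y : n → ℂ) :
    star (x ⬝ᵥ y) = star x ⬝ᵥ star y := by
  simp [dotProduct]

theorem star_dot_mulVec {n : Type*} [Fintype n] (B : Matrix n n ℂ) (x y : n → ℂ) :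
    star (star x ⬝ᵥ B *ᵥ star y) = y ⬝ᵥ Bᴴ *ᵥ x := by
  rw [star_dot, star_mulVec, star_star, star_star, dotProduct_mulVec, dotProduct_comm]

theorem core_norm (B : Matrix (Fin 3) (Fin 3) ℂ) (u v : Fin 3 → ℂ)
    (h : B * Bᴴ + vecMulVec u (star u) = Bᴴ * B + vecMulVec v (star v))
    (hs : star u ⬝ᵥ u = star v ⬝ᵥ v)
    (ha : star u ⬝ᵥ B *ᵥ u = star v ⬝ᵥ B *ᵥ v)
    (ha2 : star u ⬝ᵥ (B * B) *ᵥ u = star v ⬝ᵥ (B * B) *ᵥ v)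
    (hη : (u ⨯₃ v) ⬝ᵥ star (u ⨯₃ v) ≠ 0) :
    ‖star u ⬝ᵥ B *ᵥ star (u ⨯₃ v)‖ = ‖(u ⨯₃ v) ⬝ᵥ B *ᵥ v‖ := by
  set N := u ⨯₃ v with hN
  have hNu : N ⬝ᵥ u = 0 := by rw [dotProduct_comm]; exact dot_self_cross u v
  have hNv : N ⬝ᵥ v = 0 := by rw [dotProduct_comm]; exact dot_cross_self u v
  have r1 := resolution u v (star u ᵥ* B) (B *ᵥ u)
  have r2 := resolution u v (star v ᵥ* B) (B *ᵥ v)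
  have r3 := resolution u v (N ᵥ* Bᴴ) (B *ᵥ star N)
  have r4 := resolution u v (N ᵥ* B) (Bᴴ *ᵥ star N)
  rw [← hN] at r1 r2 r3 r4
  simp only [← dotProduct_mulVec] at r1 r2 r3 r4
  rw [mulVec_mulVec] at r1 r2 r3 r4
  have h5 : N ⬝ᵥ (B * Bᴴ) *ᵥ star N = N ⬝ᵥ (Bᴴ * B) *ᵥ star N := by
    have := congrArg (fun X => N ⬝ᵥ X *ᵥ star N) h
    simp only [add_mulVec, dotProduct_add, vecMulVec_mulVec, dotProduct_smul, hNu, hNv] at this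
    simpa [hNu, hNv] using this
  have s1 : N ⬝ᵥ Bᴴ *ᵥ u = star (star u ⬝ᵥ B *ᵥ star N) := (star_dot_mulVec B u N).symm
  have s2 : N ⬝ᵥ Bᴴ *ᵥ v = star (star v ⬝ᵥ B *ᵥ star N) := (star_dot_mulVec B v N).symm
  have s3 : star u ⬝ᵥ Bᴴ *ᵥ star N = star (N ⬝ᵥ B *ᵥ u) := by
    have := star_dot_mulVec B (star N) (star u)
    simpa using this.symm
  have s4 : star v ⬝ᵥ Bᴴ *ᵥ star N = star (N ⬝ᵥ B *ᵥ v) := by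
    have := star_dot_mulVec B (star N) (star v)
    simpa using this.symm
  have s5 : N ⬝ᵥ Bᴴ *ᵥ star N = star (N ⬝ᵥ B *ᵥ star N) := by
    have := star_dot_mulVec B (star N) N
    simpa using this.symm
  have s6 : star v ⬝ᵥ u = star (star u ⬝ᵥ v) := by
    rw [star_dot, star_star, dotProduct_comm]
  rw [s1, s2, s6] at r3
  rw [s3, s4, s6] at r4
  rw [s6] at r1 r2
  obtain ⟨s, hsr⟩ : ∃ s : ℝ, star v ⬝ᵥ v = (s : ℂ) := by
    have h0 : 0 ≤ star v ⬝ᵥ v := dotProduct_star_self_nonneg v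
    exact ⟨_, (Complex.eq_re_of_ofReal_le h0)⟩
  have hs0 : 0 ≤ s := by
    have h0 : 0 ≤ star v ⬝ᵥ v := dotProduct_star_self_nonneg v
    rw [hsr] at h0
    exact_mod_cast h0
  have hlag : N ⬝ᵥ star N = (star u ⬝ᵥ u) * (star v ⬝ᵥ v) - (star u ⬝ᵥ v) * (star v ⬝ᵥ u) := by
    simp only [hN, dotProduct, Fin.sum_univ_three, cross_apply, Pi.star_apply]
    simp
    ring
  have hpos : 0 < N ⬝ᵥ star N := lt_of_le_of_ne (dotProduct_self_star_nonneg N) hη.symm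
  apply scalar_aux _ (star v ⬝ᵥ B *ᵥ star N) (N ⬝ᵥ B *ᵥ u) _ (star u ⬝ᵥ v) s
  · rw [hlag, hs, hsr, s6, Complex.star_def, Complex.mul_conj'] at hpos
    have h6 : 0 < s * s - ‖star u ⬝ᵥ v‖ ^ 2 := by exact_mod_cast hpos
    nlinarith [norm_nonneg (star u ⬝ᵥ v)]
  · rw [← ha2, hs, ← ha] at r2
    rw [hs] at r1
    linear_combination r2 - r1
  · rw [hs, hsr] at r3 r4
    rw [s5] at r3 r4
    rw [h5] at r4
    linear_combination r4 - r3

theorem core_c (B : Matrix (Fin 3) (Fin 3) ℂ) (u v : Fin 3 → ℂ)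
    (hs : star u ⬝ᵥ u = star v ⬝ᵥ v)
    (ha : star u ⬝ᵥ B *ᵥ u = star v ⬝ᵥ B *ᵥ v)
    (hη : (u ⨯₃ v) ⬝ᵥ star (u ⨯₃ v) ≠ 0)
    (hw : (u ⨯₃ v) ⬝ᵥ (B *ᵥ v - Bᴴ *ᵥ u) = 0) :
    ∃ c : ℂ, B *ᵥ v + star c • u = Bᴴ *ᵥ u + c • v := by
  set w := B *ᵥ v - Bᴴ *ᵥ u with hwdef
  set η := (u ⨯₃ v) ⬝ᵥ star (u ⨯₃ v) with hηdef
  have hηr : star η = η := by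
    rw [hηdef, star_dot, star_star, dotProduct_comm]
  have hss : star (star v ⬝ᵥ v) = star v ⬝ᵥ v := by
    rw [star_dot, star_star, dotProduct_comm]
  have s6 : star (star v ⬝ᵥ u) = star u ⬝ᵥ v := by
    rw [star_dot, star_star, dotProduct_comm]
  have s7 : star (star v ⬝ᵥ w) = - (star u ⬝ᵥ w) := by
    have t1 := star_dot_mulVec B v (star v)
    have t2 := star_dot_mulVec Bᴴ v (star u)
    have t3 := star_dot_mulVec B u (star u)
    rw [star_star] at t1 t2 t3
    rw [conjTranspose_conjTranspose] at t2
    rw [hwdef, dotProduct_sub, dotProduct_sub, star_sub, t2, ← ha, t3]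
    ring
  have s8 : star (star u ⬝ᵥ w) = - (star v ⬝ᵥ w) := by
    rw [← star_star (star v ⬝ᵥ w), s7]; simp
  refine ⟨((star v ⬝ᵥ v) * (star v ⬝ᵥ w) - (star v ⬝ᵥ u) * (star u ⬝ᵥ w)) / η, ?_⟩
  ext i
  have r := resolution u v (Pi.single i 1) w
  rw [← hηdef, hw, hs] at r
  simp only [single_one_dotProduct] at r
  have hwi : w i = (B *ᵥ v) i - (Bᴴ *ᵥ u) i := rfl
  simp only [Pi.add_apply, Pi.smul_apply, smul_eq_mul, star_div₀, star_sub, star_mul', s6, s7, s8,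
    hηr, hss]
  rw [hwi] at r
  field_simp
  linear_combination r

theorem core_mem_SepC (B : Matrix (Fin 3) (Fin 3) ℂ) (u v : Fin 3 → ℂ)
    (h : B * Bᴴ + vecMulVec u (star u) = Bᴴ * B + vecMulVec v (star v)) :
    fromBlocks (B * Bᴴ + vecMulVec u (star u)) B Bᴴ 1 ∈ SepC (Fin 3) := by
  have hs : star u ⬝ᵥ u = star v ⬝ᵥ v := by
    simpa using core_trace B u v h 1 (by simp)
  have ha := core_trace B u v h B rfl
  have ha2 := core_trace B u v h (B * B) (Matrix.mul_assoc _ _ _).symm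
  set N := u ⨯₃ v with hN
  by_cases hN0 : N = 0
  · -- dependent case
    have huv : vecMulVec u (star u) = vecMulVec v (star v) := by
      by_cases hu : star u ⬝ᵥ u = 0
      · have hv := hu
        rw [hs] at hv
        rw [dotProduct_star_self_eq_zero.1 hu, dotProduct_star_self_eq_zero.1 hv]
      · have hc : ∀ i j, u i * v j = u j * v i := by
          have h0 := congrFun hN0 0
          have h1 := congrFun hN0 1
          have h2 := congrFun hN0 2
          simp [hN, cross_apply] at h0 h1 h2
          intro i j
          fin_cases i <;> fin_cases j <;> simp <;>
            first | rfl | linear_combination h0 | linear_combination -h0 |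
              linear_combination h1 | linear_combination -h1 | linear_combination h2 |
              linear_combination -h2
        ext i j
        apply mul_left_cancel₀ hu
        have hcs : ∀ i j, star (u i) * star (v j) = star (u j) * star (v i) := by
          intro i j; rw [← star_mul', hc, star_mul']
        conv_lhs => rw [hs]
        simp only [dotProduct, Finset.sum_mul, vecMulVec_apply, Pi.star_apply]
        refine Finset.sum_congr rfl fun k _ => ?_
        linear_combination (star (u j) * star (v k)) * hc i k + (u k * v i) * hcs j k
    rw [huv] at h
    have hBn := add_right_cancel h
    have := add_mem (normal_mem_SepC B hBn)
      (corner_mem_SepC (posSemidef_vecMulVec_self_star u))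
    simpa [fromBlocks_add] using this
  · have hη : star N ⬝ᵥ N ≠ 0 := by
      intro h0
      exact hN0 (dotProduct_star_self_eq_zero.1 h0)
    have hη' : N ⬝ᵥ star N ≠ 0 := by rwa [dotProduct_comm]
    obtain ⟨ω, hω, hq⟩ : ∃ ω : ℂ, ‖ω‖ = 1 ∧
        N ⬝ᵥ B *ᵥ v = ω * star (star u ⬝ᵥ B *ᵥ star N) := by
      have hnorm : ‖star u ⬝ᵥ B *ᵥ star N‖ = ‖N ⬝ᵥ B *ᵥ v‖ :=
        core_norm B u v h hs ha ha2 hη'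
      by_cases hp : star u ⬝ᵥ B *ᵥ star N = 0
      · refine ⟨1, by simp, ?_⟩
        rw [hp, norm_zero] at hnorm
        rw [hp, norm_eq_zero.1 hnorm.symm]; simp
      · refine ⟨N ⬝ᵥ B *ᵥ v / star (star u ⬝ᵥ B *ᵥ star N), ?_, ?_⟩
        · rw [norm_div, norm_star, hnorm, div_self]
          rw [← hnorm]; exact norm_ne_zero_iff.2 hp
        · rw [div_mul_cancel₀]; exact star_ne_zero.2 hp
    have hω1 : star ω * ω = 1 := by
      rw [Complex.star_def, Complex.conj_mul', hω]; simp
    have huu : vecMulVec (ω • u) (star (ω • u)) = vecMulVec u (star u) := by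
      ext i j
      simp only [vecMulVec_apply, Pi.smul_apply, Pi.star_apply, smul_eq_mul, star_mul']
      linear_combination (u i * star (u j)) * hω1
    have hss : star (ω • u) ⬝ᵥ (ω • u) = star v ⬝ᵥ v := by
      rw [star_smul, smul_dotProduct, dotProduct_smul, smul_smul, hω1, one_smul, hs]
    have haa : star (ω • u) ⬝ᵥ B *ᵥ (ω • u) = star v ⬝ᵥ B *ᵥ v := by
      rw [mulVec_smul, star_smul, smul_dotProduct, dotProduct_smul, smul_smul, hω1, one_smul, ha]
    have hcr : (ω • u) ⨯₃ v = ω • N := by rw [LinearMap.map_smul₂]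
    have hω0 : ω ≠ 0 := by rintro rfl; simp at hω
    obtain ⟨c, hc⟩ := core_c B (ω • u) v hss haa
      (by rw [hcr, star_smul, smul_dotProduct, dotProduct_smul]
          simp [hω0, hη'])
      (by rw [hcr, smul_dotProduct, dotProduct_sub, hq, mulVec_smul, dotProduct_smul,
            ← star_dot_mulVec]
          simp)
    have := dilation_mem_SepC B (ω • u) v c (by rw [huu]; exact h) hss hc
    rwa [huu] at this

end core

section extreme

theorem psd_factor_aux {n : Type} [Fintype n] [DecidableEq n] {X U : Matrix n n ℂ} {ev : n → ℝ}
    (hev : ∀ i, 0 ≤ ev i) (hU : Uᴴ * U = 1) (hsp : X = U * diagonal (fun i => (ev i : ℂ)) * Uᴴ) :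
    ∃ (a : Type) (_ : Fintype a) (_ : DecidableEq a) (F : Matrix a n ℂ) (R : Matrix n a ℂ),
      Fᴴ * F = X ∧ F * R = 1 := by
  classical
  refine ⟨{i // ev i ≠ 0}, inferInstance, inferInstance,
    Matrix.of fun i j => (Real.sqrt (ev i) : ℂ) * star (U j i),
    Matrix.of fun j i => U j i * (Real.sqrt (ev i) : ℂ)⁻¹, ?_, ?_⟩
  · ext j k
    have h1 : X j k = ∑ i, U j i * (ev i : ℂ) * star (U k i) := by
      rw [hsp, Matrix.mul_apply]
      simp only [mul_diagonal, conjTranspose_apply]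
    have h2 : ∑ i : {i // ev i ≠ 0}, U j i * (ev i : ℂ) * star (U k i) =
        ∑ i, U j i * (ev i : ℂ) * star (U k i) := by
      refine Fintype.sum_of_injective (Subtype.val : {i // ev i ≠ 0} → n) Subtype.val_injective
        (fun i => U j i * (ev i : ℂ) * star (U k i))
        (fun i => U j i * (ev i : ℂ) * star (U k i)) ?_ (fun _ => rfl)
      intro i hi
      have : ev i = 0 := by
        by_contra h; exact hi ⟨⟨i, h⟩, rfl⟩
      simp [this]
    rw [h1, ← h2, Matrix.mul_apply]
    refine Finset.sum_congr rfl fun i _ => ?_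
    have hsq : (Real.sqrt (ev i) : ℂ) * (Real.sqrt (ev i) : ℂ) = (ev i : ℂ) := by
      rw [← Complex.ofReal_mul, Real.mul_self_sqrt (hev i)]
    simp only [conjTranspose_apply, of_apply, star_mul', star_star]
    rw [← hsq]
    simp
    ring
  · ext i k
    have h3 := congrFun (congrFun hU i) k
    simp only [Matrix.mul_apply, conjTranspose_apply] at h3 ⊢
    have hne : ∀ l : {i // ev i ≠ 0}, (Real.sqrt (ev l) : ℂ) ≠ 0 := by
      intro l
      rw [Complex.ofReal_ne_zero, Real.sqrt_ne_zero']
      exact lt_of_le_of_ne (hev l) l.2.symm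
    have h4 : ∑ x, (of fun (i : {i // ev i ≠ 0}) j => (Real.sqrt (ev i) : ℂ) * star (U j i)) i x *
        (of fun j (i : {i // ev i ≠ 0}) => U j i * (Real.sqrt (ev i) : ℂ)⁻¹) x k
        = (Real.sqrt (ev i) : ℂ) * (∑ x, star (U x i) * U x k) * (Real.sqrt (ev k) : ℂ)⁻¹ := by
      rw [Finset.mul_sum, Finset.sum_mul]
      refine Finset.sum_congr rfl fun x _ => ?_
      simp only [of_apply]; ring
    rw [h4, h3]
    by_cases hik : i = k
    · subst hik; simp [hne]
    · have : (i : n) ≠ k := fun h => hik (Subtype.ext h)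
      simp [Matrix.one_apply, hik, this]

theorem psd_factor {n : Type} [Fintype n] [DecidableEq n] {X : Matrix n n ℂ} (hX : X.PosSemidef) :
    ∃ (a : Type) (_ : Fintype a) (_ : DecidableEq a) (F : Matrix a n ℂ) (R : Matrix n a ℂ),
      Fᴴ * F = X ∧ F * R = 1 := by
  refine psd_factor_aux (U := (hX.1.eigenvectorUnitary : Matrix n n ℂ)) hX.eigenvalues_nonneg ?_ ?_
  · have := Unitary.coe_star_mul_self hX.1.eigenvectorUnitary
    simpa [star_eq_conjTranspose] using this
  · have := hX.1.spectral_theorem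
    rw [Unitary.conjStarAlgAut_apply] at this
    exact this

section small
open scoped Matrix.Norms.L2Operator MatrixOrder

theorem herm_small {a : Type*} [Fintype a] [DecidableEq a] {G : Matrix a a ℂ}
    (hG : G.IsHermitian) :
    ∃ e : ℝ, 0 < e ∧ ∀ t : ℝ, |t| ≤ e → (1 + (t : ℂ) • G).PosSemidef := by
  refine ⟨(‖G‖ + 1)⁻¹, by positivity, fun t ht => ?_⟩
  have hsa : IsSelfAdjoint ((t : ℂ) • G) := by
    rw [isSelfAdjoint_iff, star_smul, star_eq_conjTranspose, hG.eq]; simp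
  have hle : ‖(t : ℂ) • G‖ ≤ 1 := by
    rw [norm_smul, Complex.norm_real, Real.norm_eq_abs]
    calc |t| * ‖G‖ ≤ (‖G‖ + 1)⁻¹ * (‖G‖ + 1) := by gcongr; linarith
      _ = 1 := inv_mul_cancel₀ (by positivity)
  have h1 := hsa.neg_algebraMap_norm_le_self
  have h2 : -(1 : Matrix a a ℂ) ≤ (t : ℂ) • G := by
    refine le_trans ?_ h1
    rw [neg_le_neg_iff]
    have := algebraMap_mono (Matrix a a ℂ) hle
    simpa using this
  rw [Matrix.le_iff] at h2
  have h3 : 1 + (t : ℂ) • G = (t : ℂ) • G - -1 := by rw [sub_neg_eq_add, add_comm]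
  rw [h3]; exact h2
end small

/-- Extreme rays of the PPT cone. -/
def ExtR {n : Type*} (M : Matrix (n ⊕ n) (n ⊕ n) ℂ) : Prop :=
  PPT M ∧ ∀ K L, PPT K → PPT L → K + L = M → ∃ c : ℂ, K = c • M

theorem Gam_conjTranspose {n : Type*} (M : Matrix (n ⊕ n) (n ⊕ n) ℂ) :
    Gam Mᴴ = (Gam M)ᴴ := by
  ext (i | i) (j | j) <;> rfl

theorem sandwich_inj {a n : Type*} [Fintype a] [DecidableEq a] [Fintype n]
    (V : Matrix a n ℂ) (R : Matrix n a ℂ)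
    (hVR : V * R = 1) {X Y : Matrix a a ℂ} (h : Vᴴ * X * V = Vᴴ * Y * V) : X = Y := by
  have hRV : Rᴴ * Vᴴ = 1 := by rw [← conjTranspose_mul, hVR, conjTranspose_one]
  have this : Rᴴ * (Vᴴ * X * V) * R = Rᴴ * (Vᴴ * Y * V) * R :=
    congrArg (fun Z => Rᴴ * Z * R) h
  have e : ∀ X : Matrix a a ℂ, Rᴴ * (Vᴴ * X * V) * R = X := by
    intro X
    calc Rᴴ * (Vᴴ * X * V) * R = (Rᴴ * Vᴴ) * X * (V * R) := by simp only [Matrix.mul_assoc]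
      _ = X := by rw [hRV, hVR, Matrix.one_mul, Matrix.mul_one]
  rwa [e, e] at this

theorem ext_bound_aux {d : Type*} [Fintype d] [DecidableEq d] {g : Matrix d d ℂ} {t c : ℂ}
    (htc : t ≠ 0) (hf : (2⁻¹ : ℂ) • (1 + t • g) = c • 1) :
    (t⁻¹ * (2 * c - 1)) • (1 : Matrix d d ℂ) = g := by
  have h1 : (2 : ℂ) • ((2⁻¹ : ℂ) • (1 + t • g)) = (2 : ℂ) • (c • 1) := by rw [hf]
  rw [smul_smul, smul_smul, mul_inv_cancel₀ (by norm_num), one_smul] at h1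
  rw [mul_smul, sub_smul, ← h1, one_smul, add_sub_cancel_left, smul_smul, inv_mul_cancel₀ htc,
    one_smul]

/-- Dimension count for extreme rays. -/
theorem ext_bound {n a b : Type*} [Fintype n] [Fintype a] [DecidableEq a]
    [Fintype b] [DecidableEq b] {M : Matrix (n ⊕ n) (n ⊕ n) ℂ} (hM : ExtR M)
    (V : Matrix a (n ⊕ n) ℂ) (R : Matrix (n ⊕ n) a ℂ) (hV : Vᴴ * V = M) (hVR : V * R = 1)
    (W : Matrix b (n ⊕ n) ℂ) (S : Matrix (n ⊕ n) b ℂ) (hW : Wᴴ * W = Gam M) (hWS : W * S = 1) :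
    Fintype.card a ^ 2 + Fintype.card b ^ 2 ≤ 4 * Fintype.card n ^ 2 + 1 := by
  classical
  by_contra hcon
  push Not at hcon
  let Φ : (Matrix a a ℂ × Matrix b b ℂ) →ₗ[ℂ] Matrix (n ⊕ n) (n ⊕ n) ℂ :=
    { toFun := fun p => Vᴴ * p.1 * V - Gam (Wᴴ * p.2 * W)
      map_add' := by
        intro p q
        simp only [Prod.fst_add, Prod.snd_add, Matrix.mul_add, Matrix.add_mul, Gam_add]
        abel
      map_smul' := by
        intro c p
        simp only [Prod.smul_fst, Prod.smul_snd, Matrix.mul_smul, Matrix.smul_mul, Gam_smul,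
          RingHom.id_apply, smul_sub] }
  have hΦ : ∀ p, Φ p = 0 ↔ Gam (Vᴴ * p.1 * V) = Wᴴ * p.2 * W := by
    intro p
    show Vᴴ * p.1 * V - Gam (Wᴴ * p.2 * W) = 0 ↔ _
    rw [sub_eq_zero]
    constructor
    · intro h; rw [h, Gam_Gam]
    · intro h; rw [← h, Gam_Gam]
  let e : Matrix a a ℂ × Matrix b b ℂ := (1, 1)
  obtain ⟨k, hk, hke⟩ : ∃ k, Φ k = 0 ∧ k ∉ Submodule.span ℂ {e} := by
    by_contra hno
    push Not at hno
    have hle : LinearMap.ker Φ ≤ Submodule.span ℂ {e} := fun k hk => hno k hk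
    have h1 := Submodule.finrank_mono hle
    have h2 := finrank_span_le_card (R := ℂ) ({e} : Set (Matrix a a ℂ × Matrix b b ℂ))
    rw [Set.toFinset_singleton, Finset.card_singleton] at h2
    have h3 := Φ.finrank_range_add_finrank_ker
    have h4 := (LinearMap.range Φ).finrank_le
    rw [Module.finrank_prod, Module.finrank_matrix, Module.finrank_matrix, Module.finrank_self] at h3
    rw [Module.finrank_matrix, Module.finrank_self, Fintype.card_sum] at h4
    nlinarith
  -- Hermitian part
  have hstar : ∀ p, Φ p = 0 → Φ (p.1ᴴ, p.2ᴴ) = 0 := by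
    intro p hp
    rw [hΦ] at hp ⊢
    have := congrArg conjTranspose hp
    rw [← Gam_conjTranspose] at this
    simpa [conjTranspose_mul, Matrix.mul_assoc] using this
  obtain ⟨g, hg, hge, hg1, hg2⟩ : ∃ g, Φ g = 0 ∧ g ∉ Submodule.span ℂ {e} ∧ g.1.IsHermitian ∧
      g.2.IsHermitian := by
    let k' : Matrix a a ℂ × Matrix b b ℂ := (k.1ᴴ, k.2ᴴ)
    have hk' : Φ k' = 0 := hstar k hk
    by_cases h1 : k + k' ∈ Submodule.span ℂ {e}
    · refine ⟨Complex.I • (k - k'), ?_, ?_, ?_, ?_⟩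
      · rw [map_smul, map_sub, hk, hk']; simp
      · intro h2
        apply hke
        have h3 := Submodule.smul_mem _ (2⁻¹ : ℂ)
          (Submodule.sub_mem _ h1 (Submodule.smul_mem _ Complex.I h2))
        convert h3 using 1
        rw [smul_smul, Complex.I_mul_I]
        module
      · show (Complex.I • (k.1 - k.1ᴴ))ᴴ = Complex.I • (k.1 - k.1ᴴ)
        rw [conjTranspose_smul, conjTranspose_sub, conjTranspose_conjTranspose]
        simp only [Complex.star_def, Complex.conj_I, neg_smul]
        rw [← smul_neg, neg_sub]
      · show (Complex.I • (k.2 - k.2ᴴ))ᴴ = Complex.I • (k.2 - k.2ᴴ)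
        rw [conjTranspose_smul, conjTranspose_sub, conjTranspose_conjTranspose]
        simp only [Complex.star_def, Complex.conj_I, neg_smul]
        rw [← smul_neg, neg_sub]
    · refine ⟨k + k', by rw [map_add, hk, hk', add_zero], h1, ?_, ?_⟩
      · show (k.1 + k.1ᴴ)ᴴ = k.1 + k.1ᴴ
        rw [conjTranspose_add, conjTranspose_conjTranspose, add_comm]
      · show (k.2 + k.2ᴴ)ᴴ = k.2 + k.2ᴴ
        rw [conjTranspose_add, conjTranspose_conjTranspose, add_comm]
  obtain ⟨t1, ht1, hp1⟩ := herm_small hg1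
  obtain ⟨t2, ht2, hp2⟩ := herm_small hg2
  let t := min t1 t2
  have ht : 0 < t := lt_min ht1 ht2
  rw [hΦ] at hg
  have hhalf : (0 : ℂ) ≤ 2⁻¹ := by
    rw [show (2⁻¹ : ℂ) = ((2⁻¹ : ℝ) : ℂ) by simp]
    exact_mod_cast (by norm_num : (0:ℝ) ≤ 2⁻¹)
  have hGamK : ∀ r : ℝ, Gam ((2⁻¹ : ℂ) • (Vᴴ * (1 + (r : ℂ) • g.1) * V)) =
      (2⁻¹ : ℂ) • (Wᴴ * (1 + (r : ℂ) • g.2) * W) := by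
    intro r
    rw [Gam_smul]
    congr 1
    simp only [Matrix.mul_add, Matrix.add_mul, Gam_add, Matrix.mul_smul, Matrix.smul_mul, Gam_smul,
      hg, Matrix.mul_one, hV, hW]
  have hK : ∀ r : ℝ, |r| ≤ t → PPT ((2⁻¹ : ℂ) • (Vᴴ * (1 + (r : ℂ) • g.1) * V)) := by
    intro r hr
    refine ⟨((hp1 r (hr.trans (min_le_left _ _))).conjTranspose_mul_mul_same _).smul hhalf, ?_⟩
    rw [hGamK]
    exact ((hp2 r (hr.trans (min_le_right _ _))).conjTranspose_mul_mul_same _).smul hhalf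
  obtain ⟨c, hc⟩ := hM.2 _ _ (hK t (by rw [abs_of_pos ht])) (hK (-t) (by rw [abs_neg, abs_of_pos ht]))
    (by
      rw [← smul_add, ← Matrix.add_mul, ← Matrix.mul_add]
      have : (1 + (t : ℂ) • g.1 + (1 + ((-t : ℝ) : ℂ) • g.1)) = (2 : ℂ) • 1 := by
        push_cast; module
      rw [this, Matrix.mul_smul, Matrix.smul_mul, smul_smul, Matrix.mul_one, hV]
      norm_num)
  apply hge
  have hc2 := congrArg Gam hc
  rw [hGamK, Gam_smul, ← hW] at hc2
  rw [← hV] at hc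
  have f1 : (2⁻¹ : ℂ) • (1 + (t : ℂ) • g.1) = c • 1 := by
    apply sandwich_inj V R hVR
    rw [Matrix.mul_smul, Matrix.smul_mul, Matrix.mul_smul, Matrix.smul_mul, Matrix.mul_one]
    exact hc
  have f2 : (2⁻¹ : ℂ) • (1 + (t : ℂ) • g.2) = c • 1 := by
    apply sandwich_inj W S hWS
    rw [Matrix.mul_smul, Matrix.smul_mul, Matrix.mul_smul, Matrix.smul_mul, Matrix.mul_one]
    exact hc2
  have htc : (t : ℂ) ≠ 0 := by exact_mod_cast ht.ne'
  rw [Submodule.mem_span_singleton]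
  refine ⟨(t : ℂ)⁻¹ * (2 * c - 1), ?_⟩
  exact Prod.ext (ext_bound_aux htc f1) (ext_bound_aux htc f2)

end extreme

section kernel

theorem cg_cg {n m k : Type*} [Fintype n] [Fintype m] (J : Matrix n m ℂ) (P : Matrix m k ℂ)
    (M : Matrix (n ⊕ n) (n ⊕ n) ℂ) : cg P (cg J M) = cg (J * P) M := by
  rw [← fromBlocks_toBlocks M]
  simp only [cg_fromBlocks, conjTranspose_mul, Matrix.mul_assoc]

theorem psd_sub_rank_one {n : Type*} [Fintype n] [DecidableEq n] {Q : Matrix n n ℂ}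
    (hQ : Q.PosSemidef) (x : n → ℂ) {s : ℂ} (hs : s = star x ⬝ᵥ (Q *ᵥ x)) :
    (Q - s⁻¹ • vecMulVec (Q *ᵥ x) (star (Q *ᵥ x))).PosSemidef := by
  have hs0 : 0 ≤ s := by rw [hs]; exact hQ.dotProduct_mulVec_nonneg x
  have hsr : star s = s := (IsSelfAdjoint.of_nonneg hs0).star_eq
  have hq : star x ᵥ* Q = star (Q *ᵥ x) := by rw [star_mulVec, hQ.1.eq]
  have key : (1 - s⁻¹ • vecMulVec x (star (Q *ᵥ x)))ᴴ * Q * (1 - s⁻¹ • vecMulVec x (star (Q *ᵥ x)))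
      = Q - s⁻¹ • vecMulVec (Q *ᵥ x) (star (Q *ᵥ x)) := by
    rw [conjTranspose_sub, conjTranspose_smul, conjTranspose_vecMulVec, star_star, conjTranspose_one,
      star_inv₀, hsr, Matrix.sub_mul, Matrix.one_mul, Matrix.smul_mul, vecMulVec_mul, hq,
      Matrix.mul_sub, Matrix.mul_one, Matrix.mul_smul, Matrix.sub_mul, mul_vecMulVec,
      Matrix.smul_mul, vecMulVec_mul_vecMulVec]
    have h2 : star (Q *ᵥ x) ⬝ᵥ x = s := by rw [← hq, hs, dotProduct_mulVec]
    rw [h2]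
    by_cases h0 : s = 0
    · simp [h0]
    · rw [vecMulVec_smul, smul_smul s⁻¹ s, inv_mul_cancel₀ h0, one_smul, sub_self, smul_zero, sub_zero]
  rw [← key]
  exact hQ.conjTranspose_mul_mul_same _

theorem proj_factor {N : ℕ} (g : Fin (N + 1) → ℂ) (i : Fin (N + 1)) (hi : g i ≠ 0) :
    ∃ (J : Matrix (Fin (N + 1)) (Fin N) ℂ) (P : Matrix (Fin N) (Fin (N + 1)) ℂ),
      J * P = 1 - (g i)⁻¹ • vecMulVec g (Pi.single i 1) := by
  refine ⟨Matrix.of fun a k => if a = i.succAbove k then 1 else 0,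
    Matrix.of fun k b => (1 - (g i)⁻¹ • vecMulVec g (Pi.single i 1) :
      Matrix (Fin (N + 1)) (Fin (N + 1)) ℂ) (i.succAbove k) b, ?_⟩
  ext a b
  rw [Matrix.mul_apply]
  simp only [of_apply]
  refine Fin.succAboveCases i ?_ (fun k => ?_) a
  · have : ∀ k, i ≠ i.succAbove k := fun k => (Fin.succAbove_ne i k).symm
    simp only [this, if_false, zero_mul, Finset.sum_const_zero]
    simp only [Matrix.sub_apply, Matrix.smul_apply, vecMulVec_apply, smul_eq_mul]
    by_cases hb : i = b
    · subst hb; simp [hi]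
    · simp [Matrix.one_apply_ne hb, Pi.single_eq_of_ne (Ne.symm hb)]
  · rw [Finset.sum_eq_single k]
    · simp
    · intro b _ hb
      rw [if_neg, zero_mul]
      intro h; exact hb (Fin.succAbove_right_injective h).symm
    · simp

theorem kernel_red {N : ℕ}
    (ih : ∀ M : Matrix (Fin N ⊕ Fin N) (Fin N ⊕ Fin N) ℂ, PPT M → M ∈ SepC (Fin N))
    {A B C : Matrix (Fin (N + 1)) (Fin (N + 1)) ℂ} (h : PPT (fromBlocks A B Bᴴ C))
    (g : Fin (N + 1) → ℂ) (hg : g ≠ 0) (hC : C *ᵥ g = 0) :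
    fromBlocks A B Bᴴ C ∈ SepC (Fin (N + 1)) := by
  have h1 := h.1
  have h2 := h.2
  rw [Gam_fromBlocks] at h2
  have hA : Aᴴ = A := by
    have := h1.1.eq
    rw [fromBlocks_conjTranspose, fromBlocks_inj] at this
    exact this.1
  have hCh : Cᴴ = C := by
    have := h1.1.eq
    rw [fromBlocks_conjTranspose, fromBlocks_inj] at this
    exact this.2.2.2
  have hB : ∀ {A B D C : Matrix (Fin (N + 1)) (Fin (N + 1)) ℂ}, (fromBlocks A B D C).PosSemidef →
      C *ᵥ g = 0 → B *ᵥ g = 0 := by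
    intro A B D C hM hC
    have := (hM.dotProduct_mulVec_zero_iff (Sum.elim 0 g)).1 (by
      rw [fromBlocks_mulVec]
      simp [hC, dotProduct])
    rw [fromBlocks_mulVec] at this
    ext j
    simpa using congrFun this (Sum.inl j)
  have hB1 : B *ᵥ g = 0 := hB h1 hC
  have hB2 : Bᴴ *ᵥ g = 0 := hB h2 hC
  obtain ⟨γ, hγ⟩ : ∃ γ, γ = A *ᵥ g := ⟨_, rfl⟩
  obtain ⟨s, hs⟩ : ∃ s, s = star g ⬝ᵥ γ := ⟨_, rfl⟩
  have hApsd : A.PosSemidef := by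
    have := h1.submatrix (Sum.inl : Fin (N + 1) → _)
    exact this
  have hs0 : 0 ≤ s := by rw [hs, hγ]; exact hApsd.dotProduct_mulVec_nonneg g
  have hsr : star s = s := (IsSelfAdjoint.of_nonneg hs0).star_eq
  obtain ⟨A', hA'⟩ : ∃ A', A' = A - s⁻¹ • vecMulVec γ (star γ) := ⟨_, rfl⟩
  have hsub : ∀ {B D : Matrix (Fin (N + 1)) (Fin (N + 1)) ℂ}, (fromBlocks A B D C).PosSemidef →
      D *ᵥ g = 0 → (fromBlocks A' B D C).PosSemidef := by
    intro B D hM hD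
    have e : (fromBlocks A B D C) *ᵥ (Sum.elim g 0) = Sum.elim γ 0 := by
      rw [fromBlocks_mulVec]; simp [hD, hγ, Sum.elim_comp_inl, Sum.elim_comp_inr]
    have := psd_sub_rank_one hM (Sum.elim g 0) (s := s) (by
      rw [e, hs]; simp [dotProduct])
    rw [e] at this
    convert this using 1
    rw [hA']
    ext (i | i) (j | j) <;> simp [vecMulVec_apply]
  have hppt : PPT (fromBlocks A' B Bᴴ C) := by
    refine ⟨hsub h1 hB2, ?_⟩
    rw [Gam_fromBlocks]
    exact hsub h2 hB1
  have hA'g : A' *ᵥ g = 0 := by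
    rw [hA', Matrix.sub_mulVec, ← hγ, smul_mulVec, vecMulVec_mulVec]
    have : star γ ⬝ᵥ g = s := by
      rw [← hsr, hs, star_dotProduct]
    rw [this]
    by_cases h0 : s = 0
    · have : γ = 0 := by
        rw [hγ]; apply (hApsd.dotProduct_mulVec_zero_iff g).1; rw [← hγ, ← hs, h0]
      simp [this]
    · simp [smul_smul, inv_mul_cancel₀ h0]
  have hA'h : A'ᴴ = A' := by
    have := hppt.1.1.eq
    rw [fromBlocks_conjTranspose, fromBlocks_inj] at this
    exact this.1
  obtain ⟨i, hi⟩ : ∃ i, g i ≠ 0 := by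
    by_contra hno; push Not at hno; exact hg (funext hno)
  obtain ⟨J, P, hJP⟩ := proj_factor g i hi
  have hX1 : ∀ X : Matrix (Fin (N + 1)) (Fin (N + 1)) ℂ, X *ᵥ g = 0 → X * (J * P) = X := by
    intro X hX
    rw [hJP, Matrix.mul_sub, Matrix.mul_one, Matrix.mul_smul, mul_vecMulVec, hX]
    simp
  have hX2 : ∀ X : Matrix (Fin (N + 1)) (Fin (N + 1)) ℂ, X *ᵥ g = 0 → Xᴴ *ᵥ g = 0 →
      (J * P)ᴴ * X * (J * P) = X := by
    intro X hX hX'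
    rw [Matrix.mul_assoc, hX1 X hX]
    have := congrArg conjTranspose (hX1 _ hX')
    rwa [conjTranspose_mul, conjTranspose_conjTranspose] at this
  have hM' : fromBlocks A' B Bᴴ C ∈ SepC (Fin (N + 1)) := by
    have := SepC_cg (ih _ (hppt.cg J)) P
    rw [cg_cg, cg_fromBlocks, hX2 A' hA'g (by rw [hA'h, hA'g]), hX2 B hB1 hB2,
      hX2 Bᴴ hB2 (by rw [conjTranspose_conjTranspose, hB1]), hX2 C hC (by rw [hCh, hC])] at this
    exact this
  have hsum : fromBlocks A B Bᴴ C = fromBlocks A' B Bᴴ C +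
      fromBlocks (s⁻¹ • vecMulVec γ (star γ)) 0 0 0 := by
    rw [fromBlocks_add, hA']; simp
  rw [hsum]
  refine add_mem hM' (corner_mem_SepC ((posSemidef_vecMulVec_self_star γ).smul ?_))
  exact inv_nonneg.2 hs0

end kernel

section invertible

theorem ext_count {N x y : ℕ} (hN : N ≤ 3) (h : (x + N) ^ 2 + (y + N) ^ 2 ≤ 4 * N ^ 2 + 1)
    (hxy : x = 0 ↔ y = 0) : (x = 0 ∧ y = 0) ∨ (N = 3 ∧ x = 1 ∧ y = 1) := by
  have hx : x ≤ 6 := by nlinarith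
  have hy : y ≤ 6 := by nlinarith
  interval_cases N <;> interval_cases x <;> interval_cases y <;> simp_all

theorem one_row {n a : Type*} [Fintype a] (ha : Fintype.card a = 1) (F : Matrix a n ℂ) :
    ∃ u : n → ℂ, Fᴴ * F = vecMulVec u (star u) := by
  obtain ⟨x, hx⟩ := Fintype.card_eq_one_iff.1 ha
  refine ⟨fun j => star (F x j), ?_⟩
  ext i j
  rw [Matrix.mul_apply, vecMulVec_apply, Finset.sum_eq_single x (fun b _ hb => absurd (hx b) hb)
    (fun h => absurd (Finset.mem_univ _) h)]
  simp

theorem factor_block {n a : Type*} [Fintype n] [DecidableEq n] [Fintype a] [DecidableEq a]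
    {A B D : Matrix n n ℂ} {F : Matrix a n ℂ} {R : Matrix n a ℂ} (hD : D = Bᴴ)
    (hF : Fᴴ * F = A - B * D) (hR : F * R = 1) :
    (fromBlocks F 0 D 1 : Matrix (a ⊕ n) (n ⊕ n) ℂ)ᴴ * (fromBlocks F 0 D 1 : Matrix (a ⊕ n) (n ⊕ n) ℂ) =
      fromBlocks A B D 1 ∧
    (fromBlocks F 0 D 1 : Matrix (a ⊕ n) (n ⊕ n) ℂ) *
      (fromBlocks R 0 (-(D * R)) 1 : Matrix (n ⊕ n) (a ⊕ n) ℂ) = 1 := by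
  constructor
  · rw [fromBlocks_conjTranspose, fromBlocks_multiply]
    subst hD
    simp [hF]
  · rw [fromBlocks_multiply]
    simp [hR]

theorem schur_one {n : Type*} [Fintype n] [DecidableEq n] {A B D : Matrix n n ℂ} (hD : D = Bᴴ)
    (h : (fromBlocks A B D 1).PosSemidef) : (A - B * D).PosSemidef := by
  subst hD
  have : Invertible (1 : Matrix n n ℂ) := invertibleOne
  have := (Matrix.PosDef.fromBlocks₂₂ A B (D := 1) Matrix.PosDef.one).1 h
  simpa using this

theorem empty_iff {n a : Type*} [Fintype n] [Fintype a] [DecidableEq a]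
    {X : Matrix n n ℂ} {F : Matrix a n ℂ} {R : Matrix n a ℂ} (hF : Fᴴ * F = X) (hR : F * R = 1) :
    Fintype.card a = 0 ↔ X = 0 := by
  rw [Fintype.card_eq_zero_iff]
  constructor
  · intro h
    rw [← hF]; ext i j; simp [Matrix.mul_apply]
  · intro h
    rw [h] at hF
    have h0 : F = 0 := conjTranspose_mul_self_eq_zero.1 hF
    rw [h0, Matrix.zero_mul] at hR
    refine ⟨fun x => ?_⟩
    have := congrFun (congrFun hR x) x
    simp at this

theorem ext_sep_one {N : ℕ} (hN : N ≤ 3) {A B : Matrix (Fin N) (Fin N) ℂ}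
    (hM : ExtR (fromBlocks A B Bᴴ 1)) : fromBlocks A B Bᴴ 1 ∈ SepC (Fin N) := by
  have h1 := hM.1.1
  have h2 := hM.1.2
  rw [Gam_fromBlocks] at h2
  have hX := schur_one rfl h1
  have hY := schur_one (conjTranspose_conjTranspose B).symm h2
  obtain ⟨a, _, _, F, R, hF, hR⟩ := psd_factor hX
  obtain ⟨b, _, _, F', R', hF', hR'⟩ := psd_factor hY
  obtain ⟨e1, e2⟩ := factor_block rfl hF hR
  obtain ⟨e3, e4⟩ := factor_block (conjTranspose_conjTranspose B).symm hF' hR'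
  have hb := ext_bound hM _ _ e1 e2 _ _ (by rw [Gam_fromBlocks]; exact e3) e4
  simp only [Fintype.card_sum, Fintype.card_fin] at hb
  have hxy : Fintype.card a = 0 ↔ Fintype.card b = 0 := by
    rw [empty_iff hF hR, empty_iff hF' hR', ← hX.trace_eq_zero_iff, ← hY.trace_eq_zero_iff,
      trace_sub, trace_sub, trace_mul_comm B]
  rcases ext_count hN hb hxy with ⟨ha, hb0⟩ | ⟨h3, ha, hb1⟩
  · rw [empty_iff hF hR, sub_eq_zero] at ha
    rw [empty_iff hF' hR', sub_eq_zero] at hb0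
    rw [ha]
    exact normal_mem_SepC B (ha.symm.trans hb0)
  · subst h3
    obtain ⟨u, hu⟩ := one_row ha F
    obtain ⟨v, hv⟩ := one_row hb1 F'
    have hA1 : A = B * Bᴴ + vecMulVec u (star u) := by rw [← hu, hF]; abel
    have hA2 : A = Bᴴ * B + vecMulVec v (star v) := by rw [← hv, hF']; abel
    have := core_mem_SepC B u v (hA1.symm.trans hA2)
    rwa [← hA1] at this

theorem ExtR.cg {n : Type*} [Fintype n] [DecidableEq n] {M : Matrix (n ⊕ n) (n ⊕ n) ℂ} (h : ExtR M)
    (S T : Matrix n n ℂ) (hST : S * T = 1) : ExtR (cg S M) := by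
  have hTS : T * S = 1 := mul_eq_one_comm.1 hST
  have hone : ∀ K : Matrix (n ⊕ n) (n ⊕ n) ℂ, _root_.cg (1 : Matrix n n ℂ) K = K := by
    intro K; simp [_root_.cg]
  refine ⟨h.1.cg S, fun K L hK hL hKL => ?_⟩
  obtain ⟨c, hc⟩ := h.2 _ _ (hK.cg T) (hL.cg T) (by
    have : _root_.cg T K + _root_.cg T L = _root_.cg T (K + L) := by
      simp [_root_.cg, Matrix.mul_add, Matrix.add_mul]
    rw [this, hKL, cg_cg, hST, hone])
  refine ⟨c, ?_⟩
  have := congrArg (_root_.cg S) hc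
  rw [cg_cg, hTS, hone] at this
  rw [this]
  simp [_root_.cg]

open scoped MatrixOrder in
theorem psd_square {n : Type*} [Fintype n] [DecidableEq n] {C : Matrix n n ℂ}
    (hC : C.PosSemidef) : ∃ R : Matrix n n ℂ, C = Rᴴ * R :=
  CStarAlgebra.nonneg_iff_eq_star_mul_self.mp hC.nonneg

theorem ext_sep {N : ℕ} (hN : N ≤ 3) {A B C : Matrix (Fin N) (Fin N) ℂ}
    (hM : ExtR (fromBlocks A B Bᴴ C)) (hC : C.det ≠ 0) :
    fromBlocks A B Bᴴ C ∈ SepC (Fin N) := by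
  have hCpsd : C.PosSemidef := by
    have := hM.1.1.submatrix (Sum.inr : Fin N → _)
    exact this
  obtain ⟨R, hR⟩ := psd_square hCpsd
  have hRu : IsUnit R.det := by
    rw [isUnit_iff_ne_zero]
    intro h
    apply hC; rw [hR, det_mul, h, mul_zero]
  have h1 := Matrix.mul_nonsing_inv R hRu
  have h2 := Matrix.nonsing_inv_mul R hRu
  have hE := hM.cg _ _ h2
  have hCC : (R⁻¹)ᴴ * C * R⁻¹ = 1 := by
    rw [hR, ← Matrix.mul_assoc, Matrix.mul_assoc, h1, Matrix.mul_one, ← conjTranspose_mul, h1,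
      conjTranspose_one]
  have hBB : (R⁻¹)ᴴ * Bᴴ * R⁻¹ = ((R⁻¹)ᴴ * B * R⁻¹)ᴴ := by
    simp [conjTranspose_mul, Matrix.mul_assoc]
  rw [cg_fromBlocks, hCC, hBB] at hE
  have h3 := SepC_cg (ext_sep_one hN hE) R
  rw [← hBB, ← hCC, ← cg_fromBlocks, cg_cg, h2] at h3
  simpa [cg] using h3

theorem ext_sep_succ {N : ℕ} (hN : N + 1 ≤ 3)
    (ih : ∀ M : Matrix (Fin N ⊕ Fin N) (Fin N ⊕ Fin N) ℂ, PPT M → M ∈ SepC (Fin N))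
    {M : Matrix (Fin (N + 1) ⊕ Fin (N + 1)) (Fin (N + 1) ⊕ Fin (N + 1)) ℂ} (hM : ExtR M) :
    M ∈ SepC (Fin (N + 1)) := by
  have hB : M.toBlocks₂₁ = (M.toBlocks₁₂)ᴴ := by
    ext i j
    exact (congrFun (congrFun hM.1.1.1.eq (Sum.inr i)) (Sum.inl j)).symm
  rw [← fromBlocks_toBlocks M, hB] at hM ⊢
  by_cases h : M.toBlocks₂₂.det = 0
  · obtain ⟨g, hg, hCg⟩ := Matrix.exists_mulVec_eq_zero_iff.2 h
    exact kernel_red ih hM.1 g hg hCg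
  · exact ext_sep hN hM h

end invertible

section km

attribute [local instance] Matrix.normedAddCommGroup Matrix.normedSpace

theorem isClosed_psd (n : Type*) [Fintype n] :
    IsClosed {M : Matrix n n ℂ | M.PosSemidef} := by
  have : {M : Matrix n n ℂ | M.PosSemidef} = {M | Mᴴ = M} ∩ ⋂ x : n → ℂ,
      {M | 0 ≤ star x ⬝ᵥ (M *ᵥ x)} := by
    ext M
    simp only [Set.mem_ofPred_eq, Set.mem_inter_iff, Set.mem_iInter]
    rw [posSemidef_iff_dotProduct_mulVec]
    rfl
  rw [this]
  refine IsClosed.inter (isClosed_eq (by fun_prop) (by fun_prop)) (isClosed_iInter fun x => ?_)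
  exact isClosed_le continuous_const (by fun_prop)

/-- Density matrices. -/
def psdOne (n : Type*) [Fintype n] : Set (Matrix n n ℂ) := {Q | Q.PosSemidef ∧ Q.trace = 1}

theorem isCompact_psdOne (n : Type*) [Fintype n] : IsCompact (psdOne n) := by
  classical
  refine IsCompact.of_isClosed_subset (isCompact_closedBall (0 : Matrix n n ℂ) (Fintype.card n)) ?_ ?_
  · refine (isClosed_psd n).inter (isClosed_eq ?_ continuous_const)
    exact Continuous.matrix_trace continuous_id
  · rintro Q ⟨hQ, ht⟩
    obtain ⟨R, rfl⟩ := psd_square hQ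
    have hs : ∑ i, ∑ k, ‖R k i‖ ^ 2 = 1 := by
      have : ((∑ i, ∑ k, ‖R k i‖ ^ 2 : ℝ) : ℂ) = 1 := by
        rw [← ht]
        simp only [trace, diag_apply, Matrix.mul_apply, conjTranspose_apply]
        push_cast
        refine Finset.sum_congr rfl fun i _ => Finset.sum_congr rfl fun k _ => ?_
        rw [Complex.star_def, Complex.conj_mul']
      exact_mod_cast this
    have hR : ∀ k i, ‖R k i‖ ≤ 1 := by
      intro k i
      have h1 : ‖R k i‖ ^ 2 ≤ 1 := by
        rw [← hs]
        refine le_trans ?_ (Finset.single_le_sum (f := fun i => ∑ k, ‖R k i‖ ^ 2)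
          (fun i _ => Finset.sum_nonneg fun k _ => by positivity) (Finset.mem_univ i))
        exact Finset.single_le_sum (f := fun k => ‖R k i‖ ^ 2)
          (fun i _ => by positivity) (Finset.mem_univ k)
      nlinarith [norm_nonneg (R k i)]
    rw [mem_closedBall_zero_iff, Matrix.norm_le_iff (by positivity)]
    intro i j
    rw [Matrix.mul_apply]
    refine (norm_sum_le _ _).trans ?_
    refine (Finset.sum_le_sum (g := fun _ => (1 : ℝ)) fun k _ => ?_).trans (by simp)
    rw [norm_mul, conjTranspose_apply, norm_star]
    exact mul_le_one₀ (hR k i) (norm_nonneg _) (hR k j)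

theorem continuous_Gam (n : Type*) :
    Continuous (Gam : Matrix (n ⊕ n) (n ⊕ n) ℂ → _) := by
  refine continuous_matrix fun i j => ?_
  rcases i with i | i <;> rcases j with j | j <;> exact continuous_id.matrix_elem _ _

/-- PPT density matrices. -/
def pptOne (n : Type*) [Fintype n] : Set (Matrix (n ⊕ n) (n ⊕ n) ℂ) := {M | PPT M ∧ M.trace = 1}

theorem isCompact_pptOne (n : Type*) [Fintype n] : IsCompact (pptOne n) := by
  have : pptOne n = psdOne (n ⊕ n) ∩ Gam ⁻¹' {M | M.PosSemidef} := by
    ext M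
    simp only [pptOne, psdOne, PPT, Set.mem_ofPred_eq, Set.mem_inter_iff, Set.mem_preimage]
    tauto
  rw [this]
  exact (isCompact_psdOne _).inter_right ((isClosed_psd _).preimage (continuous_Gam n))

theorem convex_pptOne (n : Type*) [Fintype n] : Convex ℝ (pptOne n) := by
  rintro M ⟨hM, hMt⟩ L ⟨hL, hLt⟩ a b ha hb hab
  rw [← Complex.coe_smul a M, ← Complex.coe_smul b L]
  refine ⟨(hM.smul (by exact_mod_cast ha)).add (hL.smul (by exact_mod_cast hb)), ?_⟩
  rw [trace_add, trace_smul, trace_smul, hMt, hLt]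
  simp only [smul_eq_mul, mul_one]
  exact_mod_cast hab

/-- Product states. -/
def prodOne (n : Type*) [Fintype n] : Set (Matrix (n ⊕ n) (n ⊕ n) ℂ) :=
  (fun p : Matrix (Fin 2) (Fin 2) ℂ × Matrix n n ℂ => tens p.1 p.2) '' (psdOne (Fin 2) ×ˢ psdOne n)

theorem isCompact_prodOne (n : Type*) [Fintype n] : IsCompact (prodOne n) := by
  refine ((isCompact_psdOne _).prod (isCompact_psdOne _)).image ?_
  refine continuous_matrix fun i j => ?_
  have h1 : ∀ a b, Continuous fun p : Matrix (Fin 2) (Fin 2) ℂ × Matrix n n ℂ => p.1 a b :=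
    fun a b => continuous_fst.matrix_elem a b
  have h2 : ∀ a b, Continuous fun p : Matrix (Fin 2) (Fin 2) ℂ × Matrix n n ℂ => p.2 a b :=
    fun a b => continuous_snd.matrix_elem a b
  rcases i with i | i <;> rcases j with j | j <;> exact (h1 _ _).mul (h2 _ _)

theorem trace_tens {n : Type*} [Fintype n] (P : Matrix (Fin 2) (Fin 2) ℂ) (Q : Matrix n n ℂ) :
    (tens P Q).trace = P.trace * Q.trace := by
  simp only [tens, trace, Fintype.sum_sum_type, diag_apply, fromBlocks_apply₁₁, fromBlocks_apply₂₂,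
    Matrix.smul_apply, smul_eq_mul, Fin.sum_univ_two, ← Finset.mul_sum, add_mul]

theorem krein_milman_fd {E : Type*} [NormedAddCommGroup E] [NormedSpace ℝ E] {s : Set E}
    (hs : IsCompact s) (hc : Convex ℝ s) : closure (convexHull ℝ (s.extremePoints ℝ)) = s :=
  closure_convexHull_extremePoints hs hc

theorem trace_conv {n : Type*} [Fintype n] {M : Matrix (n ⊕ n) (n ⊕ n) ℂ}
    (hM : M ∈ convexHull ℝ (prodOne n)) : M.trace = 1 := by
  have : convexHull ℝ (prodOne n) ⊆ {M | M.trace = 1} := by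
    refine convexHull_min ?_ ?_
    · rintro _ ⟨⟨P, Q⟩, ⟨hP, hQ⟩, rfl⟩
      show (tens P Q).trace = 1
      rw [trace_tens, hP.2, hQ.2, one_mul]
    · intro M hM L hL a b ha hb hab
      show (a • M + b • L).trace = 1
      rw [trace_add, trace_smul, trace_smul, hM, hL]
      simp only [Complex.real_smul, mul_one]
      exact_mod_cast hab
  exact this hM

theorem psd_normalise {n : Type*} [Fintype n] {Q : Matrix n n ℂ} (hQ : Q.PosSemidef) (h0 : Q ≠ 0) :
    ∃ t : ℝ, 0 < t ∧ Q.trace = t ∧ ((t : ℂ)⁻¹ • Q) ∈ psdOne n := by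
  have h1 := hQ.trace_nonneg
  have h2 : Q.trace ≠ 0 := fun h => h0 (hQ.trace_eq_zero_iff.1 h)
  obtain ⟨t, ht0, ht⟩ : ∃ t : ℝ, 0 ≤ t ∧ Q.trace = t := by
    rw [Complex.nonneg_iff] at h1
    refine ⟨Q.trace.re, h1.1, Complex.ext rfl ?_⟩
    simp [← h1.2]
  rw [ht] at h2
  have h3 : t ≠ 0 := by exact_mod_cast h2
  have ht1 : 0 < t := lt_of_le_of_ne ht0 h3.symm
  refine ⟨t, ht1, ht, hQ.smul ?_, ?_⟩
  · exact inv_nonneg.2 (by exact_mod_cast ht0)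
  · rw [trace_smul, ht, smul_eq_mul, inv_mul_cancel₀ h2]

theorem sep_conv {n : Type*} [Fintype n] {M : Matrix (n ⊕ n) (n ⊕ n) ℂ}
    (hM : M ∈ SepC n) : M = 0 ∨ ∃ t : ℝ, 0 < t ∧ ∃ m ∈ convexHull ℝ (prodOne n), M = t • m := by
  induction hM using AddSubmonoid.closure_induction with
  | zero => left; rfl
  | mem x hx =>
    obtain ⟨P, Q, hP, hQ, rfl⟩ := hx
    by_cases hP0 : P = 0
    · left; subst hP0; ext (i | i) (j | j) <;> simp [tens]
    by_cases hQ0 : Q = 0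
    · left; subst hQ0; ext (i | i) (j | j) <;> simp [tens]
    right
    obtain ⟨t, ht, -, ht2⟩ := psd_normalise hP hP0
    obtain ⟨s, hs, -, hs2⟩ := psd_normalise hQ hQ0
    refine ⟨t * s, by positivity, _, subset_convexHull ℝ _ ⟨(_, _), ⟨ht2, hs2⟩, rfl⟩, ?_⟩
    have h1 : (t : ℂ) ≠ 0 := by exact_mod_cast ht.ne'
    have h2 : (s : ℂ) ≠ 0 := by exact_mod_cast hs.ne'
    ext (i | i) (j | j) <;> simp [tens] <;> field_simp
  | add x y _ _ hx hy =>
    rcases hx with rfl | ⟨t, ht, m, hm, rfl⟩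
    · simpa using hy
    rcases hy with rfl | ⟨s, hs, m', hm', rfl⟩
    · right; exact ⟨t, ht, m, hm, by simp⟩
    right
    refine ⟨t + s, by positivity, _, (convex_convexHull ℝ (prodOne n)) hm hm'
      (a := t / (t + s)) (b := s / (t + s)) (by positivity) (by positivity) (by field_simp), ?_⟩
    rw [smul_add, smul_smul, smul_smul]
    congr 2 <;> field_simp

theorem sep_conv_one {n : Type*} [Fintype n] {M : Matrix (n ⊕ n) (n ⊕ n) ℂ}
    (hM : M ∈ SepC n) (ht : M.trace = 1) : M ∈ convexHull ℝ (prodOne n) := by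
  rcases sep_conv hM with rfl | ⟨t, _, m, hm, rfl⟩
  · simp at ht
  · rw [trace_smul, trace_conv hm, Complex.real_smul, mul_one] at ht
    have : t = 1 := by exact_mod_cast ht
    rwa [this, one_smul]

theorem conv_sep {n : Type*} [Fintype n] {M : Matrix (n ⊕ n) (n ⊕ n) ℂ}
    (hM : M ∈ convexHull ℝ (prodOne n)) : M ∈ SepC n := by
  have : convexHull ℝ (prodOne n) ⊆ (SepC n : Set _) := by
    refine convexHull_min ?_ ?_
    · rintro _ ⟨⟨P, Q⟩, ⟨hP, hQ⟩, rfl⟩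
      exact tens_mem_SepC hP.1 hQ.1
    · intro M hM L hL a b ha hb hab
      rw [← Complex.coe_smul a M, ← Complex.coe_smul b L]
      exact add_mem (SepC_smul hM (by exact_mod_cast ha)) (SepC_smul hL (by exact_mod_cast hb))
  exact this hM

theorem extreme_ExtR {n : Type*} [Fintype n] {M : Matrix (n ⊕ n) (n ⊕ n) ℂ}
    (hM : M ∈ (pptOne n).extremePoints ℝ) : ExtR M := by
  rw [mem_extremePoints] at hM
  obtain ⟨⟨hM, hMt⟩, hext⟩ := hM
  refine ⟨hM, fun K L hK hL hKL => ?_⟩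
  by_cases hK0 : K = 0
  · exact ⟨0, by simp [hK0]⟩
  by_cases hL0 : L = 0
  · exact ⟨1, by rw [one_smul, ← hKL, hL0, add_zero]⟩
  obtain ⟨t, ht, ht1, ht2⟩ := psd_normalise hK.1 hK0
  obtain ⟨s, hs, hs1, hs2⟩ := psd_normalise hL.1 hL0
  have h1 : (t : ℂ) ≠ 0 := by exact_mod_cast ht.ne'
  have h2 : (s : ℂ) ≠ 0 := by exact_mod_cast hs.ne'
  have hts : t + s = 1 := by
    have := hMt
    rw [← hKL, trace_add, ht1, hs1] at this
    exact_mod_cast this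
  have h3 := hext _ ⟨hK.smul (c := (t : ℂ)⁻¹) (inv_nonneg.2 (by exact_mod_cast ht.le)), ht2.2⟩
    _ ⟨hL.smul (c := (s : ℂ)⁻¹) (inv_nonneg.2 (by exact_mod_cast hs.le)), hs2.2⟩
    ⟨t, s, ht, hs, hts, by
      rw [← Complex.coe_smul t, ← Complex.coe_smul s, smul_smul, smul_smul, mul_inv_cancel₀ h1,
        mul_inv_cancel₀ h2, one_smul, one_smul, hKL]⟩
  refine ⟨t, ?_⟩
  rw [← h3.1, smul_smul, mul_inv_cancel₀ h1, one_smul]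

theorem ppt_of_ext {n : Type*} [Fintype n]
    (hE : ∀ M : Matrix (n ⊕ n) (n ⊕ n) ℂ, ExtR M → M ∈ SepC n)
    {M : Matrix (n ⊕ n) (n ⊕ n) ℂ} (hM : PPT M) : M ∈ SepC n := by
  by_cases h0 : M = 0
  · rw [h0]; exact zero_mem _
  obtain ⟨t, ht, ht1, ht2⟩ := psd_normalise hM.1 h0
  have h1 : (t : ℂ) ≠ 0 := by exact_mod_cast ht.ne'
  have hmem : (t : ℂ)⁻¹ • M ∈ pptOne n :=
    ⟨hM.smul (c := (t : ℂ)⁻¹) (inv_nonneg.2 (by exact_mod_cast ht.le)), ht2.2⟩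
  rw [← krein_milman_fd (isCompact_pptOne n) (convex_pptOne n)] at hmem
  have hsub : closure (convexHull ℝ ((pptOne n).extremePoints ℝ)) ⊆ convexHull ℝ (prodOne n) := by
    refine closure_minimal (convexHull_min ?_ (convex_convexHull _ _))
      (isCompact_convexHull_fd (isCompact_prodOne n)).isClosed
    intro K hK
    exact sep_conv_one (hE K (extreme_ExtR hK)) (extremePoints_subset hK).2
  have h2 := SepC_smul (conv_sep (hsub hmem)) (c := (t : ℂ)) (by exact_mod_cast ht.le)
  rwa [smul_smul, mul_inv_cancel₀ h1, one_smul] at h2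

theorem ppt_sep {N : ℕ} (hN : N ≤ 3) (M : Matrix (Fin N ⊕ Fin N) (Fin N ⊕ Fin N) ℂ)
    (hM : PPT M) : M ∈ SepC (Fin N) := by
  induction N with
  | zero =>
    have : M = 0 := Subsingleton.elim _ _
    rw [this]; exact zero_mem _
  | succ N ih =>
    exact ppt_of_ext (fun M hM => ext_sep_succ hN (fun M hM => ih (by omega) M hM) hM) hM

end km

section final

/-- Block indexing. -/
def blk (l : ℕ) : Fin l ⊕ Fin l → Fin 2 × Fin l := Sum.elim (fun j => (0, j)) (fun j => (1, j))

theorem separable_of_conv {l : ℕ} {ρ : Matrix (Fin 2 × Fin l) (Fin 2 × Fin l) ℂ}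
    (h : ρ.submatrix (blk l) (blk l) ∈ convexHull ℝ (prodOne (Fin l))) : Separable ρ := by
  rw [mem_convexHull_iff_exists_fintype] at h
  obtain ⟨ι, _, w, z, hw, hw1, hz, hsum⟩ := h
  choose pq hpq hz using hz
  let e := Fintype.equivFin ι
  refine ⟨Fintype.card ι, fun i => w (e.symm i), fun i => (pq (e.symm i)).1,
    fun i => (pq (e.symm i)).2, fun i => hw _, ?_, fun i => (hpq _).1, fun i => (hpq _).2, ?_⟩
  · rw [← hw1]; exact e.symm.sum_comp w
  · have h2 : ∀ p q, ρ (blk l p) (blk l q) = ∑ k, (w k : ℂ) * tens (pq k).1 (pq k).2 p q := by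
      intro p q
      have := congrFun (congrFun hsum p) q
      rw [submatrix_apply] at this
      rw [← this, Matrix.sum_apply]
      refine Finset.sum_congr rfl fun k _ => ?_
      rw [← hz k]
      simp
    rw [e.symm.sum_comp (fun k => (w k : ℂ) • ((pq k).1 ⊗ₖ (pq k).2))]
    ext ⟨a, i⟩ ⟨b, j⟩
    rw [Matrix.sum_apply]
    simp only [Matrix.smul_apply, kroneckerMap_apply, smul_eq_mul]
    fin_cases a <;> fin_cases b
    · exact h2 (Sum.inl i) (Sum.inl j)
    · exact h2 (Sum.inl i) (Sum.inr j)
    · exact h2 (Sum.inr i) (Sum.inl j)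
    · exact h2 (Sum.inr i) (Sum.inr j)

theorem separable_of_ppt {l : ℕ} (hl : l ≤ 3) {ρ : Matrix (Fin 2 × Fin l) (Fin 2 × Fin l) ℂ}
    (hpos : ρ.PosSemidef) (htr : ρ.trace = 1) (h : (partialTransposeSnd ρ).PosSemidef) :
    Separable ρ := by
  apply separable_of_conv
  apply sep_conv_one
  · apply ppt_sep hl
    refine ⟨hpos.submatrix _, ?_⟩
    have : Gam (ρ.submatrix (blk l) (blk l)) =
        ((partialTransposeSnd ρ)ᵀ).submatrix (blk l) (blk l) := by
      ext (i | i) (j | j) <;> rfl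
    rw [this]
    exact h.transpose.submatrix _
  · rw [← htr]
    simp only [trace, Fintype.sum_sum_type, Fintype.sum_prod_type, Fin.sum_univ_two]
    rfl

theorem ppt_of_separable {l : ℕ} {ρ : Matrix (Fin 2 × Fin l) (Fin 2 × Fin l) ℂ}
    (h : Separable ρ) : (partialTransposeSnd ρ).PosSemidef := by
  obtain ⟨n, p, σ₁, σ₂, hp, -, h1, h2, rfl⟩ := h
  have : partialTransposeSnd (∑ i, (p i : ℂ) • (σ₁ i ⊗ₖ σ₂ i)) =
      ∑ i, (p i : ℂ) • (σ₁ i ⊗ₖ (σ₂ i)ᵀ) := by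
    ext a b
    simp [partialTransposeSnd, Matrix.sum_apply]
  rw [this]
  refine posSemidef_sum _ fun i _ => ?_
  exact ((h1 i).1.kronecker (h2 i).1.transpose).smul (by exact_mod_cast hp i)

end final

/-- Peres–Horodecki: for `2 × 2` and `2 × 3` systems, a state is separable iff its
partial transpose is positive semidefinite. -/
theorem separable_iff_ppt
    (hl : l = 2 ∨ l = 3)
    (ρ : Matrix (Fin 2 × Fin l) (Fin 2 × Fin l) ℂ)
    (hpos : ρ.PosSemidef) (htr : ρ.trace = 1) :
    Separable ρ ↔ (partialTransposeSnd ρ).PosSemidef := 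
  ⟨ppt_of_separable, separable_of_ppt (by omega) hpos htr⟩
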